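/- Suppose α ≥ 1 and n ≥ 2. Then under Jack_α measure the statistic W_α has mean 0, second moment 1, and third moment (α−1)/√(α·C(n,2)); that is, Σ_{λ partition of n} π_α(λ)·W_α(λ) = 0, Σ_{λ partition of n} π_α(λ)·W_α(λ)² = 1, and Σ_{λ partition of n} π_α(λ)·W_α(λ)³ = (α−1)/√(α·C(n,2)). -/

import Mathlib

open Finset

namespace JackTest

def colLen {n : ℕ} (lam : n.Partition) (j : ℕ) : ℕ :=
  (lam.parts.filter (fun p => j < p)).card

def rowLen {n : ℕ} (lam : n.Partition) (i : ℕ) : ℕ :=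
  ((Finset.range n).filter (fun j => i < colLen lam j)).card

def cells {n : ℕ} (lam : n.Partition) : Finset (ℕ × ℕ) :=
  (Finset.range n ×ˢ Finset.range n).filter (fun s => s.2 < rowLen lam s.1)

def arm {n : ℕ} (lam : n.Partition) (s : ℕ × ℕ) : ℕ := rowLen lam s.1 - (s.2 + 1)

def leg {n : ℕ} (lam : n.Partition) (s : ℕ × ℕ) : ℕ := colLen lam s.2 - (s.1 + 1)

noncomputable def cLow (α : ℝ) {n : ℕ} (lam : n.Partition) : ℝ :=
  ∏ s ∈ cells lam, (α * arm lam s + leg lam s + 1)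

noncomputable def cUp (α : ℝ) {n : ℕ} (lam : n.Partition) : ℝ :=
  ∏ s ∈ cells lam, (α * arm lam s + leg lam s + α)

noncomputable def jackP (α : ℝ) {n : ℕ} (lam : n.Partition) : ℝ :=
  α ^ n * (n.factorial) / (cLow α lam * cUp α lam)

def nStat {n : ℕ} (lam : n.Partition) : ℕ := ∑ i ∈ Finset.range n, i * rowLen lam i

def nStatConj {n : ℕ} (lam : n.Partition) : ℕ := ∑ j ∈ Finset.range n, j * colLen lam j

noncomputable def W (α : ℝ) {n : ℕ} (lam : n.Partition) : ℝ :=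
  (α * nStatConj lam - nStat lam) / Real.sqrt (α * n.choose 2)

noncomputable def Phi (x : ℝ) : ℝ :=
  (Real.sqrt (2 * Real.pi))⁻¹ * ∫ t in Set.Iic x, Real.exp (-t ^ 2 / 2)


/-- The sum `∑ i ∈ s, x i ^ k * ∏ j ∈ t, (x i - y j) / ∏ j ∈ s \ {i}, (x i - x j)`, a divided
difference of `X ^ k * ∏ j ∈ t, (X - y j)` at the nodes `x i`. -/
noncomputable def dividedDiff (x y : ℕ → ℝ) (s t : Finset ℕ) (k : ℕ) : ℝ :=
  ∑ i ∈ s, x i ^ k * ((∏ j ∈ t, (x i - y j)) / ∏ j ∈ s.erase i, (x i - x j))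

theorem dividedDiff_insert_right (x y : ℕ → ℝ) (s : Finset ℕ) {t : Finset ℕ} {b : ℕ}
    (hb : b ∉ t) (k : ℕ) :
    dividedDiff x y s (insert b t) k =
      dividedDiff x y s t (k + 1) - y b * dividedDiff x y s t k := by
  simp only [dividedDiff, prod_insert hb, mul_sum, ← sum_sub_distrib]
  exact sum_congr rfl fun i _ => by ring

theorem dividedDiff_insert_left {x : ℕ → ℝ} (hx : Function.Injective x) (y : ℕ → ℝ)
    {s : Finset ℕ} (t : Finset ℕ) {a : ℕ} (ha : a ∉ s) (k : ℕ) :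
    dividedDiff x y (insert a s) t (k + 1) - x a * dividedDiff x y (insert a s) t k =
      dividedDiff x y s t k := by
  simp only [dividedDiff, mul_sum, ← sum_sub_distrib]
  rw [sum_insert ha]
  have h : ∀ i ∈ s, x i ^ (k + 1) * ((∏ j ∈ t, (x i - y j)) /
        ∏ j ∈ (insert a s).erase i, (x i - x j)) -
      x a * (x i ^ k * ((∏ j ∈ t, (x i - y j)) / ∏ j ∈ (insert a s).erase i, (x i - x j))) =
      x i ^ k * ((∏ j ∈ t, (x i - y j)) / ∏ j ∈ s.erase i, (x i - x j)) := by
    intro i hi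
    have hne : a ≠ i := by rintro rfl; exact ha hi
    have h0 : x i - x a ≠ 0 := sub_ne_zero.2 fun h => hne (hx h).symm
    have h1 : ∏ j ∈ s.erase i, (x i - x j) ≠ 0 :=
      prod_ne_zero_iff.2 fun j hj =>
        sub_ne_zero.2 fun h => (mem_erase.1 hj).1 (hx h).symm
    rw [erase_insert_of_ne hne, prod_insert (by simp [ha])]
    field_simp
    ring
  rw [sum_congr rfl h]
  ring

theorem dividedDiff_range_zero {x : ℕ → ℝ} (hx : Function.Injective x) (y : ℕ → ℝ) (M : ℕ) :
    dividedDiff x y (range (M + 1)) (range M) 0 = 1 := by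
  have hmonic : (∏ j ∈ range M, (Polynomial.X - Polynomial.C (y j))).Monic :=
    Polynomial.monic_prod_of_monic _ _ fun j _ => Polynomial.monic_X_sub_C _
  have hdeg : (∏ j ∈ range M, (Polynomial.X - Polynomial.C (y j))).natDegree = M := by
    rw [Polynomial.natDegree_prod_of_monic _ _ fun j _ => Polynomial.monic_X_sub_C _]
    simp
  have h := Lagrange.leadingCoeff_eq_sum (s := range (M + 1)) (v := x) hx.injOn
    (P := ∏ j ∈ range M, (Polynomial.X - Polynomial.C (y j)))
    (by rw [Polynomial.degree_eq_natDegree hmonic.ne_zero, hdeg]; simp)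
  rw [hmonic.leadingCoeff] at h
  rw [h, dividedDiff]
  simp [Polynomial.eval_prod]

theorem dividedDiff_range {x : ℕ → ℝ} (hx : Function.Injective x) (y : ℕ → ℝ) (M : ℕ) {P : ℕ → ℝ}
    (hP : ∀ k, P k = ∑ i ∈ range (M + 1), x i ^ k - ∑ j ∈ range M, y j ^ k) :
    dividedDiff x y (range (M + 1)) (range M) 1 = P 1 ∧
    dividedDiff x y (range (M + 1)) (range M) 2 = (P 1 ^ 2 + P 2) / 2 ∧
    dividedDiff x y (range (M + 1)) (range M) 3 =
      (P 1 ^ 3 + 3 * P 1 * P 2 + 2 * P 3) / 6 := by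
  induction M generalizing P with
  | zero =>
    refine ⟨?_, ?_, ?_⟩ <;> (simp [hP, dividedDiff]; try ring)
  | succ M ih =>
    obtain ⟨h1, h2, h3⟩ := ih (P := fun k => _) fun k => rfl
    have h0 := dividedDiff_range_zero hx y M
    have h0' := dividedDiff_range_zero hx y (M + 1)
    have hrec (k : ℕ) : dividedDiff x y (range (M + 1 + 1)) (range (M + 1)) (k + 1) =
        x (M + 1) * dividedDiff x y (range (M + 1 + 1)) (range (M + 1)) k +
        (dividedDiff x y (range (M + 1)) (range M) (k + 1) -
          y M * dividedDiff x y (range (M + 1)) (range M) k) := by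
      rw [← dividedDiff_insert_right x y _ notMem_range_self, ← range_add_one (n := M),
        ← dividedDiff_insert_left hx y (range (M + 1)) (notMem_range_self (n := M + 1)),
        ← range_add_one (n := M + 1)]
      ring
    have r0 := hrec 0
    have r1 := hrec 1
    have r2 := hrec 2
    simp only [zero_add, Nat.reduceAdd] at r0 r1 r2
    have hP' (k : ℕ) : P k = (∑ i ∈ range (M + 1), x i ^ k - ∑ j ∈ range M, y j ^ k) +
        x (M + 1) ^ k - y M ^ k := by
      rw [hP, sum_range_succ _ (M + 1), sum_range_succ (fun j => y j ^ k) M]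
      ring
    rw [r2, r1, r0, h0', h0, h1, h2, h3, hP' 1, hP' 2, hP' 3]
    refine ⟨?_, ?_, ?_⟩ <;> ring

/-- The content `α * f i - i` of the box that can be added to row `i` of the diagram with row
lengths `f`. -/
noncomputable def content (α : ℝ) (f : ℕ → ℕ) (i : ℕ) : ℝ := α * f i - i

theorem content_strictAnti {α : ℝ} (hα : 0 ≤ α) {f : ℕ → ℕ} (hf : Antitone f) :
    StrictAnti (content α f) := by
  intro i j hij
  have h1 : (f j : ℝ) ≤ f i := by exact_mod_cast hf hij.le
  have h2 : (i : ℝ) < j := by exact_mod_cast hij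
  have h3 := mul_le_mul_of_nonneg_left h1 hα
  simp only [content]
  linarith

/-- The length of column `k` of the diagram with row lengths `f i`, `i < M`. -/
def colCount (M : ℕ) (f : ℕ → ℕ) (k : ℕ) : ℕ := ((range M).filter fun j => k < f j).card

theorem colCount_eq {M : ℕ} {f : ℕ → ℕ} (hf : Antitone f) {s k : ℕ} (hs : s ≤ M)
    (h₁ : f s ≤ k) (h₂ : ∀ j < s, k < f j) : colCount M f k = s := by
  have : (range M).filter (fun j => k < f j) = range s := by
    ext j
    simp only [mem_filter, mem_range]
    constructor
    · rintro ⟨-, hj⟩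
      by_contra! h
      exact absurd (hf h) (by omega)
    · exact fun h => ⟨by omega, h₂ j h⟩
  rw [colCount, this, card_range]

/-- The product of `α * arm + leg + x` over the boxes in row `i`. -/
noncomputable def rowHook (α x : ℝ) (M : ℕ) (f : ℕ → ℕ) (i : ℕ) : ℝ :=
  ∏ k ∈ range (f i), (α * ((f i - (k + 1) : ℕ) : ℝ) + ((colCount M f k - (i + 1) : ℕ) : ℝ) + x)

/-- The product of `α * arm + leg + x` over all boxes. -/
noncomputable def hook (α x : ℝ) (M : ℕ) (f : ℕ → ℕ) : ℝ := ∏ i ∈ range M, rowHook α x M f i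

theorem rowHook_pos {α x : ℝ} (hα : 0 < α) (hx : 0 < x) (M : ℕ) (f : ℕ → ℕ) (i : ℕ) :
    0 < rowHook α x M f i := prod_pos fun _ _ => by positivity

theorem hook_pos {α x : ℝ} (hα : 0 < α) (hx : 0 < x) (M : ℕ) (f : ℕ → ℕ) :
    0 < hook α x M f := prod_pos fun _ _ => rowHook_pos hα hx _ _ _

theorem hook_succ (α x : ℝ) {M : ℕ} {f : ℕ → ℕ} (hM : f M = 0) :
    hook α x (M + 1) f = hook α x M f := by
  have h (k : ℕ) : colCount (M + 1) f k = colCount M f k := by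
    simp [colCount, range_add_one, filter_insert, hM]
  simp [hook, rowHook, prod_range_succ, h, hM]

/-- Adds a box to row `r`. -/
def addBox (f : ℕ → ℕ) (r : ℕ) : ℕ → ℕ := Function.update f r (f r + 1)

theorem addBox_self (f : ℕ → ℕ) (r : ℕ) : addBox f r r = f r + 1 := by simp [addBox]

theorem addBox_of_ne (f : ℕ → ℕ) {r i : ℕ} (h : i ≠ r) : addBox f r i = f i := by
  simp [addBox, h]

theorem content_addBox_self (α : ℝ) (f : ℕ → ℕ) (r : ℕ) :
    content α (addBox f r) r = content α f r + α := by
  simp only [content, addBox_self]; push_cast; ring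

theorem content_addBox_of_ne (α : ℝ) (f : ℕ → ℕ) {r i : ℕ} (h : i ≠ r) :
    content α (addBox f r) i = content α f i := by
  simp only [content, addBox_of_ne f h]

theorem colCount_addBox_of_ne (M : ℕ) (f : ℕ → ℕ) {r k : ℕ} (hk : k ≠ f r) :
    colCount M (addBox f r) k = colCount M f k := by
  unfold colCount
  congr 1
  refine filter_congr fun j _ => ?_
  by_cases h : j = r
  · subst h; rw [addBox_self]; omega
  · rw [addBox_of_ne f h]

theorem colCount_self {M : ℕ} {f : ℕ → ℕ} (hf : Antitone f) {r : ℕ} (hr : r < M)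
    (hadd : ∀ i < r, f r < f i) : colCount M f (f r) = r :=
  colCount_eq hf hr.le le_rfl hadd

theorem addBox_antitone {f : ℕ → ℕ} (hf : Antitone f) {r : ℕ} (hadd : ∀ i < r, f r < f i) :
    Antitone (addBox f r) := by
  intro i j hij
  have := hf hij
  by_cases hi : i = r <;> by_cases hj : j = r
  · subst hi; subst hj; exact le_rfl
  · subst hi; rw [addBox_self, addBox_of_ne f hj]; omega
  · subst hj; rw [addBox_self, addBox_of_ne f hi]; exact hadd i (by omega)
  · rwa [addBox_of_ne f hi, addBox_of_ne f hj]

theorem colCount_addBox_self {M : ℕ} {f : ℕ → ℕ} (hf : Antitone f) {r : ℕ} (hr : r < M)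
    (hadd : ∀ i < r, f r < f i) : colCount M (addBox f r) (f r) = r + 1 := by
  refine colCount_eq (addBox_antitone hf hadd) (by omega) ?_ fun j hj => ?_
  · rw [addBox_of_ne f (by omega)]; exact hf (by omega)
  · by_cases h : j = r
    · subst h; rw [addBox_self]; omega
    · rw [addBox_of_ne f h]; exact hadd j (by omega)

theorem rowHook_addBox_of_gt (α x : ℝ) (M : ℕ) {f : ℕ → ℕ} (hf : Antitone f) {r i : ℕ}
    (hi : r < i) : rowHook α x M (addBox f r) i = rowHook α x M f i := by
  unfold rowHook
  rw [addBox_of_ne f hi.ne']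
  refine prod_congr rfl fun k hk => ?_
  have := hf hi.le
  rw [mem_range] at hk
  rw [colCount_addBox_of_ne M f (by omega)]

theorem rowHook_addBox_of_lt (α x : ℝ) {M : ℕ} {f : ℕ → ℕ} (hf : Antitone f) {r i : ℕ}
    (hr : r < M) (hadd : ∀ i < r, f r < f i) (hi : i < r) :
    rowHook α x M (addBox f r) i * (content α f i - content α f r - α + x - 1) =
      rowHook α x M f i * (content α f i - content α f r - α + x) := by
  unfold rowHook
  have hmem : f r ∈ range (f i) := mem_range.2 (hadd i hi)
  rw [addBox_of_ne f hi.ne, ← mul_prod_erase _ _ hmem, ← mul_prod_erase _ _ hmem,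
    prod_congr rfl fun k hk => by rw [colCount_addBox_of_ne M f (ne_of_mem_erase hk)],
    colCount_addBox_self hf hr hadd, colCount_self hf hr hadd]
  have h1 : ((f i - (f r + 1) : ℕ) : ℝ) = f i - f r - 1 := by
    rw [Nat.cast_sub (hadd i hi)]; push_cast; ring
  have h2 : ((r - (i + 1) : ℕ) : ℝ) = r - i - 1 := by
    rw [Nat.cast_sub hi]; push_cast; ring
  have h3 : ((r + 1 - (i + 1) : ℕ) : ℝ) = r - i := by
    rw [Nat.cast_sub (by omega)]; push_cast; ring
  rw [h1, h2, h3]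
  simp only [content]
  ring

theorem prod_Ico_mul_right (φ : ℕ → ℝ) {a b : ℕ} (hab : a ≤ b) :
    (∏ k ∈ Ico a b, φ k) * φ b = φ a * ∏ k ∈ Ico a b, φ (k + 1) := by
  induction b, hab using Nat.le_induction with
  | base => simp
  | succ b hab ih => rw [prod_Ico_succ_top hab, prod_Ico_succ_top hab, ih]; ring

theorem rowHook_telescope (α x : ℝ) {M : ℕ} {f : ℕ → ℕ} (hf : Antitone f) {r s : ℕ}
    (hrs : r ≤ s) (hs : s ≤ M) :
    (∏ k ∈ Ico (f s) (f r), (α * (f r - k : ℝ) + ((colCount M f k - (r + 1) : ℕ) : ℝ) + x)) *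
        ∏ j ∈ Ico r s, (content α f r - content α f j + x) =
      (∏ k ∈ Ico (f s) (f r),
          (α * (f r - (k + 1 : ℕ) : ℝ) + ((colCount M f k - (r + 1) : ℕ) : ℝ) + x)) *
        ∏ j ∈ Ico r s, (content α f r - content α f (j + 1) + x - 1) := by
  induction s, hrs using Nat.le_induction with
  | base => simp
  | succ s hrs ih =>
    have ih := ih (by omega)
    have hsr : f s ≤ f r := hf hrs
    have hss : f (s + 1) ≤ f s := hf (by omega)
    rw [← prod_Ico_consecutive _ hss hsr, ← prod_Ico_consecutive _ hss hsr,
      prod_Ico_succ_top hrs, prod_Ico_succ_top hrs]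
    have hleg (k : ℕ) (hk : k ∈ Ico (f (s + 1)) (f s)) :
        ((colCount M f k - (r + 1) : ℕ) : ℝ) = s - r := by
      rw [mem_Ico] at hk
      rw [colCount_eq hf hs hk.1 fun j hj => hk.2.trans_le (hf (by omega)),
        Nat.cast_sub (by omega)]
      push_cast; ring
    have hprod (u : ℕ → ℝ) :
        ∏ k ∈ Ico (f (s + 1)) (f s), (u k + ((colCount M f k - (r + 1) : ℕ) : ℝ) + x) =
          ∏ k ∈ Ico (f (s + 1)) (f s), (u k + (s - r) + x) :=
      prod_congr rfl fun k hk => by rw [hleg k hk]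
    rw [hprod, hprod]
    have hblock := prod_Ico_mul_right (fun k => α * (f r - k : ℝ) + (s - r) + x) hss
    have e1 : content α f r - content α f s + x = α * (f r - f s : ℝ) + (s - r) + x := by
      simp only [content]; ring
    have e2 : content α f r - content α f (s + 1) + x - 1 =
        α * (f r - f (s + 1) : ℝ) + (s - r) + x := by
      simp only [content]; push_cast; ring
    rw [e1, e2]
    linear_combination (∏ k ∈ Ico (f s) (f r),
      (α * (f r - k : ℝ) + ((colCount M f k - (r + 1) : ℕ) : ℝ) + x)) *
        (∏ j ∈ Ico r s, (content α f r - content α f j + x)) * hblock +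
      (α * (f r - f (s + 1) : ℝ) + (s - r) + x) *
        (∏ k ∈ Ico (f (s + 1)) (f s), (α * (f r - (k + 1 : ℕ) : ℝ) + (s - r) + x)) * ih

theorem rowHook_addBox_self (α x : ℝ) {M : ℕ} {f : ℕ → ℕ} (hf : Antitone f)
    (hM : f M = 0) {r : ℕ} (hr : r < M) (hadd : ∀ i < r, f r < f i) :
    rowHook α x M (addBox f r) r *
        ∏ j ∈ Ico (r + 1) M, (content α f r - content α f j + x) =
      rowHook α x M f r * (content α f r + M + x - 1) *
        ∏ j ∈ Ico (r + 1) M, (content α f r - content α f j + x - 1) := by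
  have h := rowHook_telescope α x hf hr.le le_rfl
  have e1 : rowHook α x M (addBox f r) r =
      (∏ k ∈ Ico 0 (f r), (α * (f r - k : ℝ) + ((colCount M f k - (r + 1) : ℕ) : ℝ) + x)) * x := by
    rw [rowHook, addBox_self, prod_range_succ, colCount_addBox_self hf hr hadd,
      Nat.Ico_zero_eq_range]
    simp only [Nat.sub_self, Nat.cast_zero, mul_zero, zero_add]
    congr 1
    refine prod_congr rfl fun k hk => ?_
    rw [mem_range] at hk
    rw [colCount_addBox_of_ne M f hk.ne, Nat.add_sub_add_right, Nat.cast_sub hk.le]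
  have e2 : rowHook α x M f r = ∏ k ∈ Ico 0 (f r),
      (α * (f r - (k + 1 : ℕ) : ℝ) + ((colCount M f k - (r + 1) : ℕ) : ℝ) + x) := by
    rw [rowHook, Nat.Ico_zero_eq_range]
    refine prod_congr rfl fun k hk => ?_
    rw [mem_range] at hk
    rw [Nat.cast_sub hk]
  have e3 : ∏ j ∈ Ico r M, (content α f r - content α f (j + 1) + x - 1) =
      (∏ j ∈ Ico (r + 1) M, (content α f r - content α f j + x - 1)) *
        (content α f r + M + x - 1) := by
    have hMc : content α f M = -M := by simp [content, hM]
    rw [prod_Ico_add' (fun j => content α f r - content α f j + x - 1) r M 1,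
      prod_Ico_succ_top (by omega), hMc]
    ring
  rw [hM, e3, prod_eq_prod_Ico_succ_bot hr, ← e2] at h
  rw [e1]
  simp only [sub_self, zero_add] at h
  linear_combination h

theorem hook_addBox (α x : ℝ) {M : ℕ} {f : ℕ → ℕ} (hf : Antitone f)
    (hM : f M = 0) {r : ℕ} (hr : r < M) (hadd : ∀ i < r, f r < f i) :
    hook α x M (addBox f r) *
        ((∏ i ∈ range r, (content α f i - content α f r - α + x - 1)) *
          ∏ j ∈ Ico (r + 1) M, (content α f r - content α f j + x)) =
      hook α x M f * (content α f r + M + x - 1) *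
        ((∏ i ∈ range r, (content α f i - content α f r - α + x)) *
          ∏ j ∈ Ico (r + 1) M, (content α f r - content α f j + x - 1)) := by
  have h1 : (∏ i ∈ range r, rowHook α x M (addBox f r) i) *
      (∏ i ∈ range r, (content α f i - content α f r - α + x - 1)) =
      (∏ i ∈ range r, rowHook α x M f i) *
      ∏ i ∈ range r, (content α f i - content α f r - α + x) := by
    rw [← prod_mul_distrib, ← prod_mul_distrib]
    exact prod_congr rfl fun i hi => rowHook_addBox_of_lt α x hf hr hadd (mem_range.1 hi)
  have h2 : ∏ i ∈ Ico (r + 1) M, rowHook α x M (addBox f r) i =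
      ∏ i ∈ Ico (r + 1) M, rowHook α x M f i :=
    prod_congr rfl fun i hi => rowHook_addBox_of_gt α x M hf (by rw [mem_Ico] at hi; omega)
  have h3 := rowHook_addBox_self α x hf hM hr hadd
  have hsplit (g : ℕ → ℝ) : ∏ i ∈ range M, g i =
      (∏ i ∈ range r, g i) * (g r * ∏ i ∈ Ico (r + 1) M, g i) := by
    rw [← prod_eq_prod_Ico_succ_bot hr, prod_range_mul_prod_Ico _ hr.le]
  rw [hook, hook, hsplit, hsplit, h2]
  set a := ∏ i ∈ range r, rowHook α x M (addBox f r) i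
  set b := ∏ i ∈ Ico (r + 1) M, rowHook α x M f i
  set u := ∏ j ∈ Ico (r + 1) M, (content α f r - content α f j + x)
  set v := ∏ i ∈ range r, (content α f i - content α f r - α + x)
  linear_combination b * rowHook α x M (addBox f r) r * u * h1 +
    (∏ i ∈ range r, rowHook α x M f i) * v * b * h3

theorem prod_range_erase (g : ℕ → ℝ) {r M : ℕ} (hr : r < M) :
    ∏ i ∈ (range M).erase r, g i = (∏ i ∈ range r, g i) * ∏ i ∈ Ico (r + 1) M, g i := by
  rw [← prod_union]
  · congr 1
    ext i
    simp only [mem_erase, mem_range, mem_union, mem_Ico]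
    omega
  · rw [disjoint_left]
    intro i
    simp only [mem_range, mem_Ico]
    omega

/-- The probability that the box added to the diagram `f` in the Jack growth process is in
row `r`. -/
noncomputable def upProb (α : ℝ) (n : ℕ) (f : ℕ → ℕ) (r : ℕ) : ℝ :=
  (∏ j ∈ range n, (content α f r - (content α f j - 1))) /
    ∏ j ∈ (range (n + 1)).erase r, (content α f r - content α f j)

/-- `α * (n + 1)` times the probability that the box removed from the diagram `f` with `n + 1`
boxes is in row `r`. -/
noncomputable def downWeight (α : ℝ) (n : ℕ) (f : ℕ → ℕ) (r : ℕ) : ℝ :=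
  (content α f r + n) * ((∏ j ∈ (range (n + 1)).erase r, (content α f r - 1 - content α f j)) /
    ∏ j ∈ (range (n + 1)).erase r, (content α f r - content α f j))

theorem prod_content_sub_ne_zero {α : ℝ} (hα : 0 ≤ α) {f : ℕ → ℕ} (hf : Antitone f)
    (s : Finset ℕ) (r : ℕ) : ∏ j ∈ s.erase r, (content α f r - content α f j) ≠ 0 :=
  prod_ne_zero_iff.2 fun _ hj =>
    sub_ne_zero.2 fun h => (mem_erase.1 hj).1 ((content_strictAnti hα hf).injective h).symm

theorem hook_mul_upProb {α : ℝ} (hα : 0 < α) {n : ℕ} {f : ℕ → ℕ} (hf : Antitone f)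
    (hn : f n = 0) {r : ℕ} (hr : r ≤ n) (hadd : ∀ i < r, f r < f i) :
    hook α 1 (n + 1) (addBox f r) * hook α α (n + 1) (addBox f r) * upProb α n f r =
      hook α 1 n f * hook α α n f * downWeight α n (addBox f r) r := by
  have hr' : r < n + 1 := by omega
  have hM : f (n + 1) = 0 := Nat.le_zero.1 (hn ▸ hf n.le_succ)
  have h1 := hook_addBox α 1 hf hM hr' hadd
  have h2 := hook_addBox α α hf hM hr' hadd
  rw [hook_succ α _ hn] at h1 h2
  set ℓ := content α f with hℓ
  set E := (range (n + 1)).erase r with hE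
  have s1 : (∏ i ∈ range r, (ℓ i - ℓ r - α + 1 - 1)) * (∏ i ∈ range r, (ℓ i - ℓ r - α + α - 1)) =
      (∏ i ∈ range r, (ℓ r - ℓ i + 1)) * ∏ i ∈ range r, (ℓ r - ℓ i + α) := by
    rw [← prod_mul_distrib, ← prod_mul_distrib]
    exact prod_congr rfl fun i _ => by ring
  have s2 : (∏ i ∈ range r, (ℓ i - ℓ r - α + 1)) * (∏ i ∈ range r, (ℓ i - ℓ r - α + α)) =
      (∏ i ∈ range r, (ℓ r - ℓ i + α - 1)) * ∏ i ∈ range r, (ℓ r - ℓ i + 1 - 1) := by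
    rw [← prod_mul_distrib, ← prod_mul_distrib]
    exact prod_congr rfl fun i _ => by ring
  have key : hook α 1 (n + 1) (addBox f r) * hook α α (n + 1) (addBox f r) *
      ((∏ j ∈ E, (ℓ r - ℓ j + 1)) * ∏ j ∈ E, (ℓ r - ℓ j + α)) =
      hook α 1 n f * hook α α n f * ((ℓ r + n + 1) * (ℓ r + α + n)) *
      ((∏ j ∈ E, (ℓ r - ℓ j + 1 - 1)) * ∏ j ∈ E, (ℓ r - ℓ j + α - 1)) := by
    rw [hE, prod_range_erase _ hr', prod_range_erase _ hr', prod_range_erase _ hr',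
      prod_range_erase _ hr']
    push_cast at h1 h2
    generalize ∏ i ∈ range r, (ℓ i - ℓ r - α + 1 - 1) = a₁ at *
    generalize ∏ i ∈ range r, (ℓ i - ℓ r - α + α - 1) = a₂ at *
    generalize ∏ i ∈ range r, (ℓ i - ℓ r - α + 1) = b₁ at *
    generalize ∏ i ∈ range r, (ℓ i - ℓ r - α + α) = b₂ at *
    generalize ∏ j ∈ Ico (r + 1) (n + 1), (ℓ r - ℓ j + 1) = c₁ at *
    generalize ∏ j ∈ Ico (r + 1) (n + 1), (ℓ r - ℓ j + α) = c₂ at *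
    generalize ∏ j ∈ Ico (r + 1) (n + 1), (ℓ r - ℓ j + 1 - 1) = d₁ at *
    generalize ∏ j ∈ Ico (r + 1) (n + 1), (ℓ r - ℓ j + α - 1) = d₂ at *
    linear_combination hook α α (n + 1) (addBox f r) * (a₂ * c₂) * h1 +
      hook α 1 n f * (ℓ r + (n + 1) + 1 - 1) * (b₁ * d₁) * h2 -
      hook α 1 (n + 1) (addBox f r) * hook α α (n + 1) (addBox f r) * c₁ * c₂ * s1 +
      hook α 1 n f * hook α α n f * ((ℓ r + n + 1) * (ℓ r + α + n)) * d₁ * d₂ * s2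
  have hup : upProb α n f r * ((ℓ r + n + 1) * ∏ j ∈ E, (ℓ r - ℓ j)) =
      ∏ j ∈ E, (ℓ r - ℓ j + 1) := by
    have h0 := prod_content_sub_ne_zero hα.le hf (range (n + 1)) r
    have hsplit := mul_prod_erase (range (n + 1)) (fun j => ℓ r - (ℓ j - 1)) (mem_range.2 hr')
    have hc : ℓ n = -n := by simp [hℓ, content, hn]
    rw [prod_range_succ, hc] at hsplit
    have e : ∏ j ∈ E, (ℓ r - ℓ j + 1) = ∏ j ∈ E, (ℓ r - (ℓ j - 1)) :=
      prod_congr rfl fun j _ => by ring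
    rw [upProb, ← hℓ, ← hE, e]
    rw [← hℓ, ← hE] at h0
    field_simp
    linear_combination -hsplit
  have hdown : downWeight α n (addBox f r) r * ∏ j ∈ E, (ℓ r - ℓ j + α) =
      (ℓ r + α + n) * ∏ j ∈ E, (ℓ r - ℓ j + α - 1) := by
    have h0 := prod_content_sub_ne_zero hα.le (addBox_antitone hf hadd) (range (n + 1)) r
    have e1 : ∏ j ∈ E, (content α (addBox f r) r - content α (addBox f r) j) =
        ∏ j ∈ E, (ℓ r - ℓ j + α) := prod_congr rfl fun j hj => by
      rw [content_addBox_self, content_addBox_of_ne α f (ne_of_mem_erase hj)]; ring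
    have e2 : ∏ j ∈ E, (content α (addBox f r) r - 1 - content α (addBox f r) j) =
        ∏ j ∈ E, (ℓ r - ℓ j + α - 1) := prod_congr rfl fun j hj => by
      rw [content_addBox_self, content_addBox_of_ne α f (ne_of_mem_erase hj)]; ring
    rw [← hE, e1] at h0
    rw [downWeight, ← hE, e1, e2, content_addBox_self, ← hℓ]
    field_simp
  have hα0 : ∏ j ∈ E, (ℓ r - ℓ j + α) ≠ 0 := by
    have h0 := prod_content_sub_ne_zero hα.le (addBox_antitone hf hadd) (range (n + 1)) r
    rwa [prod_congr rfl fun j hj => by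
      rw [content_addBox_self, content_addBox_of_ne α f (ne_of_mem_erase hj), add_sub_right_comm]]
      at h0
  have h00 := prod_content_sub_ne_zero hα.le hf (range (n + 1)) r
  rw [← hℓ, ← hE] at h00
  have hpos : ℓ r + n + 1 ≠ 0 := by
    have h3 : (r : ℝ) ≤ n := by exact_mod_cast hr
    have h4 : 0 ≤ α * (f r : ℝ) := by positivity
    have : 0 < ℓ r + n + 1 := by simp only [hℓ, content]; linarith
    exact this.ne'
  simp only [add_sub_cancel_right] at key
  refine mul_right_cancel₀ (mul_ne_zero hα0 (mul_ne_zero hpos h00)) ?_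
  rw [← hup] at key
  linear_combination key - hook α 1 n f * hook α α n f *
    ((ℓ r + n + 1) * ∏ j ∈ E, (ℓ r - ℓ j)) * hdown

/-- The sum of the contents of all boxes. -/
noncomputable def totalContent (α : ℝ) (n : ℕ) (f : ℕ → ℕ) : ℝ :=
  ∑ i ∈ range n, (α * (f i * (f i - 1) / 2) - i * f i)

theorem sum_content_sub_sq (α : ℝ) (f : ℕ → ℕ) (m : ℕ) :
    ∑ i ∈ range m, content α f i ^ 2 - ∑ i ∈ range m, (content α f i - 1) ^ 2 =
      2 * α * ∑ i ∈ range m, (f i : ℝ) - m ^ 2 := by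
  induction m with
  | zero => simp
  | succ m ih =>
    simp only [sum_range_succ, content] at *
    push_cast
    linear_combination ih

theorem sum_content_sub_cube (α : ℝ) (f : ℕ → ℕ) (m : ℕ) :
    ∑ i ∈ range m, content α f i ^ 3 - ∑ i ∈ range m, (content α f i - 1) ^ 3 =
      6 * α * totalContent α m f + 3 * α * (α - 1) * ∑ i ∈ range m, (f i : ℝ) + m ^ 3 := by
  induction m with
  | zero => simp [totalContent]
  | succ m ih =>
    simp only [sum_range_succ, content, totalContent] at *
    push_cast
    linear_combination ih

theorem sum_upProb {α : ℝ} (hα : 0 ≤ α) {n : ℕ} {f : ℕ → ℕ} (hf : Antitone f)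
    (hn : f n = 0) (hsum : ∑ i ∈ range n, f i = n) :
    ∑ r ∈ range (n + 1), upProb α n f r = 1 ∧
    ∑ r ∈ range (n + 1), upProb α n f r * content α f r = 0 ∧
    ∑ r ∈ range (n + 1), upProb α n f r * content α f r ^ 2 = α * n ∧
    ∑ r ∈ range (n + 1), upProb α n f r * content α f r ^ 3 =
      2 * α * totalContent α n f + α * (α - 1) * n := by
  have hinj := (content_strictAnti hα hf).injective
  have h0 := dividedDiff_range_zero hinj (fun j => content α f j - 1) n
  obtain ⟨h1, h2, h3⟩ := dividedDiff_range hinj (fun j => content α f j - 1) n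
    (P := fun k => _) fun k => rfl
  have hc : content α f n = -n := by simp [content, hn]
  have hsum' : ∑ i ∈ range n, (f i : ℝ) = n := by exact_mod_cast hsum
  have q2 := sum_content_sub_sq α f n
  have q3 := sum_content_sub_cube α f n
  have q1 : ∑ i ∈ range n, content α f i - ∑ i ∈ range n, (content α f i - 1) = n := by
    rw [← sum_sub_distrib]; simp
  rw [hsum'] at q2 q3
  simp only [sum_range_succ _ n, hc, pow_one] at h1 h2 h3
  have p1 : ∑ i ∈ range n, content α f i + -(n : ℝ) - ∑ i ∈ range n, (content α f i - 1) = 0 := by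
    linear_combination q1
  rw [p1] at h1 h2 h3
  have conv (k : ℕ) : ∑ r ∈ range (n + 1), upProb α n f r * content α f r ^ k =
      dividedDiff (content α f) (fun j => content α f j - 1) (range (n + 1)) (range n) k :=
    sum_congr rfl fun r _ => mul_comm _ _
  refine ⟨?_, ?_, ?_, ?_⟩
  · simpa [h0] using conv 0
  · simpa [h1] using conv 1
  · rw [conv, h2]; linear_combination q2 / 2
  · rw [conv, h3]; linear_combination q3 / 3

theorem sum_downWeight {α : ℝ} (hα : 0 ≤ α) {n : ℕ} {f : ℕ → ℕ} (hf : Antitone f)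
    (hn : f (n + 1) = 0) (hsum : ∑ i ∈ range (n + 1), f i = n + 1) :
    ∑ r ∈ range (n + 1), downWeight α n f r = α * (n + 1) := by
  set y : ℕ → ℝ := fun j => content α f j - 1 with hy
  have hinj : Function.Injective y := fun i j h =>
    (content_strictAnti hα hf).injective (sub_left_injective h)
  have h0 := dividedDiff_range_zero hinj (content α f) n
  obtain ⟨h1, h2, -⟩ := dividedDiff_range hinj (content α f) n (P := fun k => _) fun k => rfl
  have hc : content α f (n + 1) = -(n + 1) := by simp [content, hn]
  have hsum' : ∑ i ∈ range (n + 1), (f i : ℝ) = n + 1 := by exact_mod_cast hsum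
  have conv : ∑ r ∈ range (n + 1), downWeight α n f r =
      -dividedDiff y (content α f) (range (n + 1)) (range (n + 2)) 0 := by
    rw [dividedDiff, ← sum_neg_distrib]
    refine sum_congr rfl fun r hr => ?_
    rw [prod_range_succ, ← mul_prod_erase _ _ hr, hc]
    simp only [hy, downWeight, sub_sub_sub_cancel_right]
    ring
  have hD : dividedDiff y (content α f) (range (n + 1)) (range (n + 2)) 0 =
      dividedDiff y (content α f) (range (n + 1)) (range n) 2 -
        (content α f n + content α f (n + 1)) *
          dividedDiff y (content α f) (range (n + 1)) (range n) 1 +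
        content α f n * content α f (n + 1) := by
    rw [range_add_one (n := n + 1), dividedDiff_insert_right _ _ _ notMem_range_self,
      range_add_one (n := n)]
    rw [dividedDiff_insert_right _ _ _ notMem_range_self,
      dividedDiff_insert_right _ _ _ notMem_range_self, ← range_add_one, h0]
    ring
  have q2 := sum_content_sub_sq α f (n + 1)
  have q1 : ∑ i ∈ range (n + 1), content α f i - ∑ i ∈ range (n + 1), y i = n + 1 := by
    rw [← sum_sub_distrib]; simp [hy]
  rw [hsum', sum_range_succ (fun i => content α f i ^ 2)] at q2
  rw [sum_range_succ (fun i => content α f i)] at q1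
  simp only [pow_one] at h1 h2
  have p1 : ∑ i ∈ range (n + 1), y i - ∑ i ∈ range n, content α f i =
      content α f n - (n + 1) := by linear_combination -q1
  rw [p1] at h1 h2
  rw [conv, hD, h1, h2, hc]
  push_cast at q2
  linear_combination q2 / 2

theorem colLen_antitone {n : ℕ} (lam : n.Partition) : Antitone (colLen lam) := fun _ _ hij =>
  Multiset.card_le_card (Multiset.monotone_filter_right _ fun _ h => hij.trans_lt h)

theorem colLen_le {n : ℕ} (lam : n.Partition) (j : ℕ) : colLen lam j ≤ n := by
  have h1 : colLen lam j ≤ lam.parts.card := Multiset.card_le_card (Multiset.filter_le _ _)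
  have h2 : lam.parts.card • 1 ≤ lam.parts.sum :=
    Multiset.card_nsmul_le_sum fun p hp => lam.parts_pos hp
  rw [lam.parts_sum, smul_eq_mul, mul_one] at h2
  exact h1.trans h2

theorem colLen_eq_zero {n : ℕ} (lam : n.Partition) {j : ℕ} (hj : n ≤ j) : colLen lam j = 0 := by
  rw [colLen, Multiset.card_eq_zero, Multiset.filter_eq_nil]
  intro p hp
  have := lam.le_of_mem_parts hp
  omega

theorem card_filter_range_lt {n c : ℕ} (hc : c ≤ n) :
    ((range n).filter fun i => i < c).card = c := by
  have : (range n).filter (fun i => i < c) = range c := by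
    ext i; simp only [mem_filter, mem_range]; omega
  rw [this, card_range]

theorem lt_rowLen_iff {n : ℕ} (lam : n.Partition) (i j : ℕ) :
    j < rowLen lam i ↔ i < colLen lam j := by
  rw [rowLen]
  constructor
  · intro h
    by_contra! h'
    have : (range n).filter (fun k => i < colLen lam k) ⊆ range j := by
      intro k hk
      rw [mem_filter] at hk
      rw [mem_range]
      by_contra! hjk
      exact absurd (colLen_antitone lam hjk) (by omega)
    have := card_le_card this
    rw [card_range] at this
    omega
  · intro h
    have : range (j + 1) ⊆ (range n).filter (fun k => i < colLen lam k) := by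
      intro k hk
      rw [mem_range] at hk
      have h1 := colLen_antitone lam (show k ≤ j by omega)
      rw [mem_filter, mem_range]
      refine ⟨?_, by omega⟩
      by_contra! hnk
      have := colLen_eq_zero lam hnk
      omega
    have := card_le_card this
    rw [card_range] at this
    omega

theorem rowLen_antitone {n : ℕ} (lam : n.Partition) : Antitone (rowLen lam) := fun i j hij => by
  by_contra! h
  rw [lt_rowLen_iff] at h
  have := (lt_rowLen_iff lam i (rowLen lam i)).2 (by omega)
  omega

theorem rowLen_eq_zero {n : ℕ} (lam : n.Partition) : rowLen lam n = 0 := by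
  by_contra h
  have h' := (lt_rowLen_iff lam n 0).1 (by omega)
  have := colLen_le lam 0
  omega

theorem rowLen_le {n : ℕ} (lam : n.Partition) (i : ℕ) : rowLen lam i ≤ n :=
  (card_filter_le _ _).trans (card_range n).le

theorem colCount_rowLen {n : ℕ} (lam : n.Partition) (j : ℕ) :
    colCount n (rowLen lam) j = colLen lam j := by
  simp only [colCount, lt_rowLen_iff]
  exact card_filter_range_lt (colLen_le lam j)

theorem sum_rowLen {n : ℕ} (lam : n.Partition) : ∑ i ∈ range n, rowLen lam i = n := by
  have h1 : ∑ i ∈ range n, rowLen lam i = ∑ j ∈ range n, colLen lam j := by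
    simp only [rowLen, card_filter]
    rw [sum_comm]
    refine sum_congr rfl fun j _ => ?_
    rw [← card_filter, card_filter_range_lt (colLen_le lam j)]
  have h2 (s : Multiset ℕ) (hs : ∀ p ∈ s, p ≤ n) :
      ∑ j ∈ range n, (s.filter fun p => j < p).card = s.sum := by
    induction s using Multiset.induction with
    | empty => simp
    | cons a s ih =>
      rw [Multiset.sum_cons, ← ih fun p hp => hs p (Multiset.mem_cons_of_mem hp)]
      simp only [Multiset.filter_cons, Multiset.card_add, sum_add_distrib]
      congr 1
      refine Eq.trans ?_ (card_filter_range_lt (hs a (Multiset.mem_cons_self a s)))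
      rw [card_filter]
      refine sum_congr rfl fun j _ => ?_
      split_ifs <;> rfl
  rw [h1]
  exact (h2 lam.parts fun p hp => lam.le_of_mem_parts hp).trans lam.parts_sum

theorem rowLen_injective (n : ℕ) : Function.Injective (rowLen (n := n)) := by
  intro lam mu h
  have hcol (j : ℕ) : colLen lam j = colLen mu j := by
    rw [← colCount_rowLen, h, colCount_rowLen]
  have hcount (nu : n.Partition) (p : ℕ) :
      colLen nu p = nu.parts.count (p + 1) + colLen nu (p + 1) := by
    rw [colLen, colLen, ← Multiset.card_replicate (nu.parts.count (p + 1)) (p + 1),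
      ← Multiset.filter_eq', ← Multiset.card_add]
    rw [Multiset.filter_add_filter (fun a => a = p + 1) (fun a => p + 1 < a)]
    have e1 : nu.parts.filter (fun a => a = p + 1 ∧ p + 1 < a) = 0 := by
      rw [Multiset.filter_eq_nil]; intro a _; omega
    rw [e1, add_zero]
    congr 1
    refine Multiset.filter_congr fun a _ => ?_
    omega
  ext p
  rcases p with _ | p
  · rw [Multiset.count_eq_zero_of_notMem fun h0 => (lam.parts_pos h0).ne rfl,
      Multiset.count_eq_zero_of_notMem fun h0 => (mu.parts_pos h0).ne rfl]
  · have h1 := hcount lam p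
    have h2 := hcount mu p
    have h3 := hcol p
    have h4 := hcol (p + 1)
    omega

theorem exists_rowLen_eq {n : ℕ} {f : ℕ → ℕ} (hf : Antitone f) (hn : f n = 0)
    (hsum : ∑ i ∈ range n, f i = n) : ∃ lam : n.Partition, rowLen lam = f := by
  refine ⟨Nat.Partition.ofSums n ((range n).val.map f) hsum, ?_⟩
  have hcol (j : ℕ) : colLen (Nat.Partition.ofSums n ((range n).val.map f) hsum) j =
      colCount n f j := by
    simp only [colLen, Nat.Partition.ofSums, Multiset.filter_filter, Multiset.filter_map,
      Multiset.card_map, colCount]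
    rw [card_def, filter_val]
    congr 1
    refine Multiset.filter_congr fun i _ => ?_
    simp only [Function.comp]
    omega
  funext i
  refine eq_of_forall_lt_iff fun j => ?_
  rw [lt_rowLen_iff, hcol]
  constructor
  · intro h
    by_contra! h'
    have : (range n).filter (fun k => j < f k) ⊆ range i := by
      intro k hk
      rw [mem_filter] at hk
      rw [mem_range]
      by_contra! hik
      exact absurd (hf hik) (by omega)
    have := card_le_card this
    rw [card_range] at this
    exact absurd h (by rw [colCount]; omega)
  · intro h
    have : range (i + 1) ⊆ (range n).filter (fun k => j < f k) := by
      intro k hk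
      rw [mem_range] at hk
      have h1 := hf (show k ≤ i by omega)
      rw [mem_filter, mem_range]
      refine ⟨?_, by omega⟩
      by_contra! hnk
      have := hf hnk
      omega
    have := card_le_card this
    rw [card_range] at this
    rw [colCount]
    omega

open Classical in
/-- The sequences of row lengths of the partitions of `n`. -/
noncomputable def diagrams (n : ℕ) : Finset (ℕ → ℕ) :=
  (univ : Finset n.Partition).image rowLen

theorem mem_diagrams {n : ℕ} {f : ℕ → ℕ} :
    f ∈ diagrams n ↔ Antitone f ∧ f n = 0 ∧ ∑ i ∈ range n, f i = n := by
  simp only [diagrams, mem_image, mem_univ, true_and]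
  constructor
  · rintro ⟨lam, rfl⟩
    exact ⟨rowLen_antitone lam, rowLen_eq_zero lam, sum_rowLen lam⟩
  · rintro ⟨hf, hn, hsum⟩
    exact exists_rowLen_eq hf hn hsum

theorem prod_cells_eq_hook (α x : ℝ) {n : ℕ} (lam : n.Partition) :
    ∏ s ∈ cells lam, (α * arm lam s + leg lam s + x) = hook α x n (rowLen lam) := by
  rw [cells, prod_filter, prod_product, hook]
  refine prod_congr rfl fun i _ => ?_
  simp only
  rw [← prod_filter, rowHook]
  have : (range n).filter (fun k => k < rowLen lam i) = range (rowLen lam i) := by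
    ext k
    have := rowLen_le lam i
    simp only [mem_filter, mem_range]
    omega
  rw [this]
  exact prod_congr rfl fun k _ => by rw [arm, leg, colCount_rowLen]

/-- The Jack measure of the diagram `f` with `n` boxes. -/
noncomputable def jackWeight (α : ℝ) (n : ℕ) (f : ℕ → ℕ) : ℝ :=
  α ^ n * n.factorial / (hook α 1 n f * hook α α n f)

theorem jackP_eq (α : ℝ) {n : ℕ} (lam : n.Partition) :
    jackP α lam = jackWeight α n (rowLen lam) := by
  rw [jackP, jackWeight, cLow, cUp, prod_cells_eq_hook, prod_cells_eq_hook]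

theorem sub_nStat_eq (α : ℝ) {n : ℕ} (lam : n.Partition) :
    α * nStatConj lam - nStat lam = totalContent α n (rowLen lam) := by
  have h : (nStatConj lam : ℝ) =
      ∑ i ∈ range n, (rowLen lam i * (rowLen lam i - 1) / 2 : ℝ) := by
    have h1 : nStatConj lam = ∑ i ∈ range n, ∑ j ∈ range (rowLen lam i), j := by
      simp only [nStatConj, ← colCount_rowLen, colCount, card_filter, mul_sum, mul_ite, mul_one,
        mul_zero]
      rw [sum_comm]
      refine sum_congr rfl fun i _ => ?_
      rw [← sum_filter]
      refine sum_congr ?_ fun _ _ => rfl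
      ext k
      have := rowLen_le lam i
      simp only [mem_filter, mem_range]
      omega
    rw [h1]
    push_cast
    refine sum_congr rfl fun i _ => ?_
    induction rowLen lam i with
    | zero => simp
    | succ m ih => rw [sum_range_succ, ih]; push_cast; ring
  rw [h, nStat, totalContent, mul_sum]
  push_cast
  rw [← sum_sub_distrib]

open Classical in
theorem sum_partition_eq (α : ℝ) (n : ℕ) (g : ℝ → ℝ) :
    ∑ lam : n.Partition, jackP α lam * g (α * nStatConj lam - nStat lam) =
      ∑ f ∈ diagrams n, jackWeight α n f * g (totalContent α n f) := by
  rw [diagrams, sum_image (rowLen_injective n).injOn]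
  exact sum_congr rfl fun lam _ => by rw [jackP_eq, sub_nStat_eq]

theorem upProb_eq_zero (α : ℝ) {n : ℕ} {f : ℕ → ℕ} (hf : Antitone f) {r : ℕ} (hr : r ≤ n)
    (hadd : ¬∀ i < r, f r < f i) : upProb α n f r = 0 := by
  push Not at hadd
  obtain ⟨i, hir, hi⟩ := hadd
  obtain ⟨s, rfl⟩ : ∃ s, r = s + 1 := ⟨r - 1, by omega⟩
  have h1 := hf (show i ≤ s by omega)
  have h2 := hf (show s ≤ s + 1 by omega)
  have h3 : f s = f (s + 1) := by omega
  rw [upProb, prod_eq_zero (mem_range.2 (show s < n by omega)), zero_div]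
  simp only [content, h3]
  push_cast
  ring

theorem downWeight_eq_zero (α : ℝ) {n : ℕ} {f : ℕ → ℕ} (hf : Antitone f) (hn : f (n + 1) = 0)
    {r : ℕ} (hr : r ≤ n) (hrem : ¬f (r + 1) < f r) : downWeight α n f r = 0 := by
  have h1 : f (r + 1) = f r := le_antisymm (hf r.le_succ) (by omega)
  rcases hr.lt_or_eq with hr | rfl
  · rw [downWeight, prod_eq_zero (i := r + 1) (by simp [hr]), zero_div, mul_zero]
    simp only [content, h1]
    push_cast
    ring
  · rw [downWeight, content, ← h1, hn]
    simp

/-- Removes a box from row `r`. -/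
def removeBox (f : ℕ → ℕ) (r : ℕ) : ℕ → ℕ := Function.update f r (f r - 1)

theorem removeBox_addBox (f : ℕ → ℕ) (r : ℕ) : removeBox (addBox f r) r = f := by
  simp [removeBox, addBox]

theorem addBox_removeBox {f : ℕ → ℕ} {r : ℕ} (h : 0 < f r) : addBox (removeBox f r) r = f := by
  simp [removeBox, addBox, Nat.sub_add_cancel h]

theorem sum_addBox (g : ℕ → ℕ → ℝ) (f : ℕ → ℕ) {r M : ℕ} (hr : r < M) :
    ∑ i ∈ range M, g i (addBox f r i) =
      ∑ i ∈ range M, g i (f i) + (g r (f r + 1) - g r (f r)) := by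
  have h : ∑ i ∈ (range M).erase r, g i (addBox f r i) = ∑ i ∈ (range M).erase r, g i (f i) :=
    sum_congr rfl fun i hi => by rw [addBox_of_ne f (ne_of_mem_erase hi)]
  rw [← add_sum_erase _ _ (mem_range.2 hr), ← add_sum_erase (range M) (fun i => g i (f i))
    (mem_range.2 hr), h, addBox_self]
  ring

theorem sum_addBox_nat (f : ℕ → ℕ) {r M : ℕ} (hr : r < M) :
    ∑ i ∈ range M, addBox f r i = ∑ i ∈ range M, f i + 1 := by
  have h := sum_addBox (fun _ m => (m : ℝ)) f hr
  push_cast at h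
  rw [add_sub_cancel_left] at h
  exact_mod_cast h

theorem addBox_mem_diagrams {n : ℕ} {f : ℕ → ℕ} (hf : f ∈ diagrams n) {r : ℕ} (hr : r ≤ n)
    (hadd : ∀ i < r, f r < f i) : addBox f r ∈ diagrams (n + 1) := by
  obtain ⟨hanti, hn, hsum⟩ := mem_diagrams.1 hf
  refine mem_diagrams.2 ⟨addBox_antitone hanti hadd, ?_, ?_⟩
  · rw [addBox_of_ne f (by omega)]
    exact Nat.le_zero.1 (hn ▸ hanti n.le_succ)
  · rw [sum_addBox_nat f (by omega), sum_range_succ, hsum, hn]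

theorem removeBox_mem_diagrams {n : ℕ} {f : ℕ → ℕ} (hf : f ∈ diagrams (n + 1)) {r : ℕ}
    (hr : r ≤ n) (hrem : f (r + 1) < f r) :
    removeBox f r ∈ diagrams n ∧ ∀ i < r, removeBox f r r < removeBox f r i := by
  obtain ⟨hanti, hn, hsum⟩ := mem_diagrams.1 hf
  have hself : removeBox f r r = f r - 1 := by simp [removeBox]
  have hne (i : ℕ) (hi : i ≠ r) : removeBox f r i = f i := by simp [removeBox, hi]
  have hadd (i : ℕ) (hi : i < r) : removeBox f r r < removeBox f r i := by
    have := hanti hi.le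
    rw [hself, hne i hi.ne]
    omega
  have hanti' : Antitone (removeBox f r) := by
    intro i j hij
    have := hanti hij
    by_cases hi : i = r <;> by_cases hj : j = r
    · subst hi; subst hj; exact le_rfl
    · subst hi
      have := hanti (show i + 1 ≤ j by omega)
      rw [hself, hne j hj]; omega
    · subst hj; exact (hadd i (by omega)).le
    · rwa [hne i hi, hne j hj]
  have hsum' : ∑ i ∈ range (n + 1), removeBox f r i = n := by
    have := sum_addBox_nat (removeBox f r) (show r < n + 1 by omega)
    rw [addBox_removeBox (by omega), hsum] at this
    omega
  have hn' : removeBox f r n = 0 := by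
    by_contra h
    have h1 : ∑ i ∈ range (n + 1), 1 ≤ ∑ i ∈ range (n + 1), removeBox f r i := by
      refine sum_le_sum fun i hi => ?_
      have := hanti' (show i ≤ n by rw [mem_range] at hi; omega)
      omega
    rw [hsum'] at h1
    simp at h1
  refine ⟨mem_diagrams.2 ⟨hanti', hn', ?_⟩, hadd⟩
  rwa [sum_range_succ, hn', add_zero] at hsum'

theorem jackWeight_mul_upProb {α : ℝ} (hα : 0 < α) {n : ℕ} {f : ℕ → ℕ} (hf : f ∈ diagrams n)
    {r : ℕ} (hr : r ≤ n) (hadd : ∀ i < r, f r < f i) :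
    jackWeight α n f * upProb α n f r =
      jackWeight α (n + 1) (addBox f r) * (downWeight α n (addBox f r) r / (α * (n + 1))) := by
  obtain ⟨hanti, hn, -⟩ := mem_diagrams.1 hf
  have h := hook_mul_upProb hα hanti hn hr hadd
  have p1 := (hook_pos hα one_pos n f).ne'
  have p2 := (hook_pos hα hα n f).ne'
  have p3 := (hook_pos hα one_pos (n + 1) (addBox f r)).ne'
  have p4 := (hook_pos hα hα (n + 1) (addBox f r)).ne'
  have p5 : (n : ℝ) + 1 ≠ 0 := by positivity
  rw [jackWeight, jackWeight, Nat.factorial_succ]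
  push_cast
  field_simp
  linear_combination α ^ (n + 1) * h

theorem sum_jackWeight_succ {α : ℝ} (hα : 0 < α) (n : ℕ) (g : (ℕ → ℕ) → ℝ) :
    ∑ f ∈ diagrams (n + 1), jackWeight α (n + 1) f * g f =
      ∑ f ∈ diagrams n, jackWeight α n f *
        ∑ r ∈ range (n + 1), upProb α n f r * g (addBox f r) := by
  have hα' : α * (n + 1 : ℝ) ≠ 0 := by positivity
  have h1 : ∑ f ∈ diagrams (n + 1), jackWeight α (n + 1) f * g f =
      ∑ p ∈ diagrams (n + 1) ×ˢ range (n + 1),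
        jackWeight α (n + 1) p.1 * (downWeight α n p.1 p.2 / (α * (n + 1))) * g p.1 := by
    rw [sum_product]
    refine sum_congr rfl fun f hf => ?_
    obtain ⟨hanti, hn, hsum⟩ := mem_diagrams.1 hf
    simp only
    rw [← sum_mul, ← mul_sum, ← sum_div, sum_downWeight hα.le hanti hn hsum, div_self hα', mul_one]
  have h2 : ∑ f ∈ diagrams n, jackWeight α n f *
        ∑ r ∈ range (n + 1), upProb α n f r * g (addBox f r) =
      ∑ p ∈ diagrams n ×ˢ range (n + 1),
        jackWeight α n p.1 * upProb α n p.1 p.2 * g (addBox p.1 p.2) := by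
    rw [sum_product]
    simp only [mul_sum, mul_assoc]
  rw [h1, h2]
  have hmem {n m : ℕ} {p : (ℕ → ℕ) × ℕ} (hp : p ∈ diagrams n ×ˢ range (m + 1)) :
      p.1 ∈ diagrams n ∧ p.2 ≤ m := by
    rw [mem_product, mem_range] at hp
    exact ⟨hp.1, by omega⟩
  have hrem {p : (ℕ → ℕ) × ℕ} (hp : p ∈ diagrams (n + 1) ×ˢ range (n + 1))
      (h : jackWeight α (n + 1) p.1 * (downWeight α n p.1 p.2 / (α * (n + 1))) * g p.1 ≠ 0) :
      p.1 (p.2 + 1) < p.1 p.2 := by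
    obtain ⟨hp1, hp2⟩ := hmem hp
    obtain ⟨hanti, hn, -⟩ := mem_diagrams.1 hp1
    by_contra h'
    exact h (by rw [downWeight_eq_zero α hanti hn hp2 h']; simp)
  have hadd {p : (ℕ → ℕ) × ℕ} (hp : p ∈ diagrams n ×ˢ range (n + 1))
      (h : jackWeight α n p.1 * upProb α n p.1 p.2 * g (addBox p.1 p.2) ≠ 0) :
      ∀ i < p.2, p.1 p.2 < p.1 i := by
    obtain ⟨hp1, hp2⟩ := hmem hp
    by_contra h'
    exact h (by rw [upProb_eq_zero α (mem_diagrams.1 hp1).1 hp2 h']; simp)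
  symm
  refine sum_bij_ne_zero (fun p _ _ => (addBox p.1 p.2, p.2)) ?_ ?_ ?_ ?_
  · intro p hp h
    obtain ⟨hp1, hp2⟩ := hmem hp
    rw [mem_product, mem_range]
    exact ⟨addBox_mem_diagrams hp1 hp2 (hadd hp h), by simp only; omega⟩
  · intro p _ _ q _ _ hpq
    rw [Prod.mk.injEq] at hpq
    obtain ⟨h1, h2⟩ := hpq
    refine Prod.ext ?_ h2
    rw [← removeBox_addBox p.1 p.2, h1, h2, removeBox_addBox]
  · intro p hp h
    obtain ⟨hp1, hp2⟩ := hmem hp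
    have hr := hrem hp h
    obtain ⟨hmem', hadd'⟩ := removeBox_mem_diagrams hp1 hp2 hr
    have hback : addBox (removeBox p.1 p.2) p.2 = p.1 := addBox_removeBox (by omega)
    refine ⟨(removeBox p.1 p.2, p.2), ?_, ?_, ?_⟩
    · rw [mem_product, mem_range]
      exact ⟨hmem', by simp only; omega⟩
    · simp only
      rwa [jackWeight_mul_upProb hα hmem' hp2 hadd', hback]
    · simp only [hback]
  · intro p hp h
    obtain ⟨hp1, hp2⟩ := hmem hp
    simp only
    rw [jackWeight_mul_upProb hα hp1 hp2 (hadd hp h)]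

theorem totalContent_addBox (α : ℝ) {n : ℕ} {f : ℕ → ℕ} (hn : f n = 0) {r : ℕ} (hr : r ≤ n) :
    totalContent α (n + 1) (addBox f r) = totalContent α n f + content α f r := by
  have h := sum_addBox (fun i m => α * (m * (m - 1) / 2) - i * m) f (show r < n + 1 by omega)
  rw [totalContent, h, totalContent, content, sum_range_succ, hn]
  push_cast
  ring

theorem sum_upProb_totalContent {α : ℝ} (hα : 0 ≤ α) {n : ℕ} {f : ℕ → ℕ} (hf : f ∈ diagrams n) :
    (∑ r ∈ range (n + 1), upProb α n f r * 1 = 1) ∧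
    (∑ r ∈ range (n + 1), upProb α n f r * totalContent α (n + 1) (addBox f r) =
      totalContent α n f) ∧
    (∑ r ∈ range (n + 1), upProb α n f r * totalContent α (n + 1) (addBox f r) ^ 2 =
      totalContent α n f ^ 2 + α * n) ∧
    (∑ r ∈ range (n + 1), upProb α n f r * totalContent α (n + 1) (addBox f r) ^ 3 =
      totalContent α n f ^ 3 + (3 * n + 2) * α * totalContent α n f + α * (α - 1) * n) := by
  obtain ⟨hanti, hn, hsum⟩ := mem_diagrams.1 hf
  obtain ⟨h0, h1, h2, h3⟩ := sum_upProb hα hanti hn hsum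
  set c := totalContent α n f
  have hstep (r : ℕ) (hr : r ∈ range (n + 1)) :
      totalContent α (n + 1) (addBox f r) = c + content α f r :=
    totalContent_addBox α hn (by rw [mem_range] at hr; omega)
  have hsum_pow (k : ℕ) : ∑ r ∈ range (n + 1),
      upProb α n f r * totalContent α (n + 1) (addBox f r) ^ k =
      ∑ r ∈ range (n + 1), upProb α n f r * (c + content α f r) ^ k :=
    sum_congr rfl fun r hr => by rw [hstep r hr]
  refine ⟨by simpa using h0, ?_, ?_, ?_⟩
  · have := hsum_pow 1
    simp only [pow_one, mul_add, sum_add_distrib, ← sum_mul, h0, h1] at this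
    rw [this]; ring
  · have e (r : ℕ) : upProb α n f r * (c + content α f r) ^ 2 =
        upProb α n f r * c ^ 2 + upProb α n f r * content α f r * (2 * c) +
          upProb α n f r * content α f r ^ 2 := by ring
    simp only [hsum_pow, e, sum_add_distrib, ← sum_mul, h0, h1, h2]
    ring
  · have e (r : ℕ) : upProb α n f r * (c + content α f r) ^ 3 =
        upProb α n f r * c ^ 3 + upProb α n f r * content α f r * (3 * c ^ 2) +
          upProb α n f r * content α f r ^ 2 * (3 * c) +
            upProb α n f r * content α f r ^ 3 := by ring
    simp only [hsum_pow, e, sum_add_distrib, ← sum_mul, h0, h1, h2, h3]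
    ring

theorem sum_jackWeight_totalContent {α : ℝ} (hα : 0 < α) (n : ℕ) :
    (∑ f ∈ diagrams n, jackWeight α n f * 1 = 1) ∧
    (∑ f ∈ diagrams n, jackWeight α n f * totalContent α n f = 0) ∧
    (∑ f ∈ diagrams n, jackWeight α n f * totalContent α n f ^ 2 = α * n.choose 2) ∧
    (∑ f ∈ diagrams n, jackWeight α n f * totalContent α n f ^ 3 =
      α * (α - 1) * n.choose 2) := by
  induction n with
  | zero => simp [diagrams, jackWeight, hook, totalContent]
  | succ n ih =>
    obtain ⟨h0, h1, h2, h3⟩ := ih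
    have hchoose : ((n + 1).choose 2 : ℝ) = n.choose 2 + n := by
      rw [Nat.choose_succ_succ' n 1, Nat.choose_one_right]
      push_cast
      ring
    simp only [mul_one] at h0
    refine ⟨?_, ?_, ?_, ?_⟩
    · rw [sum_jackWeight_succ hα n fun _ => 1]
      rw [sum_congr rfl fun f hf => by rw [(sum_upProb_totalContent hα.le hf).1]]
      simpa using h0
    · rw [sum_jackWeight_succ hα n fun f => totalContent α (n + 1) f]
      rw [sum_congr rfl fun f hf => by rw [(sum_upProb_totalContent hα.le hf).2.1]]
      exact h1
    · rw [sum_jackWeight_succ hα n fun f => totalContent α (n + 1) f ^ 2]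
      rw [sum_congr rfl fun f hf => by rw [(sum_upProb_totalContent hα.le hf).2.2.1]]
      simp only [mul_add, sum_add_distrib, ← sum_mul, h0, h2, hchoose]
      ring
    · rw [sum_jackWeight_succ hα n fun f => totalContent α (n + 1) f ^ 3]
      rw [sum_congr rfl fun f hf => by rw [(sum_upProb_totalContent hα.le hf).2.2.2]]
      have e (f : ℕ → ℕ) : jackWeight α n f * (totalContent α n f ^ 3 +
          (3 * n + 2) * α * totalContent α n f + α * (α - 1) * n) =
          jackWeight α n f * totalContent α n f ^ 3 +
            jackWeight α n f * totalContent α n f * ((3 * n + 2) * α) +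
              jackWeight α n f * (α * (α - 1) * n) := by ring
      simp only [e, sum_add_distrib, ← sum_mul, h0, h1, h3, hchoose]
      ring

/-- Corollary: `E(W_α) = 0`, `E(W_α²) = 1`, `E(W_α³) = (α-1)/√(α C(n,2))`. -/
theorem jack_W_moments (α : ℝ) (hα : 1 ≤ α) (n : ℕ) (hn : 2 ≤ n) :
    (∑ lam : n.Partition, jackP α lam * W α lam) = 0 ∧
    (∑ lam : n.Partition, jackP α lam * W α lam ^ 2) = 1 ∧
    (∑ lam : n.Partition, jackP α lam * W α lam ^ 3) =
      (α - 1) / Real.sqrt (α * n.choose 2) := by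
  have hα0 : 0 < α := by linarith
  obtain ⟨-, h1, h2, h3⟩ := sum_jackWeight_totalContent hα0 n
  have hchoose : 0 < (n.choose 2 : ℝ) := by exact_mod_cast Nat.choose_pos hn
  have hpos : 0 < α * (n.choose 2 : ℝ) := by positivity
  set s := Real.sqrt (α * n.choose 2) with hs
  have hs0 : s ≠ 0 := (Real.sqrt_pos.2 hpos).ne'
  have hsq : s ^ 2 = α * n.choose 2 := Real.sq_sqrt hpos.le
  have e (k : ℕ) : ∑ lam : n.Partition, jackP α lam * W α lam ^ k =
      (∑ f ∈ diagrams n, jackWeight α n f * totalContent α n f ^ k) / s ^ k := by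
    rw [← sum_partition_eq α n fun c => c ^ k, sum_div]
    exact sum_congr rfl fun lam _ => by rw [W, ← hs, div_pow, mul_div_assoc]
  refine ⟨by simpa [h1] using e 1, ?_, ?_⟩
  · rw [e, h2, hsq, div_self hpos.ne']
  · rw [e, h3, div_eq_div_iff (pow_ne_zero _ hs0) hs0]
    linear_combination -(α - 1) * s * hsq

end JackTest
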